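/- Let m ≥ 1 and s ≥ 1 be fixed, and let G be a graph on n vertices whose vertex set is partitioned into sets V_1, ..., V_s such that: (i) for each i < s there is no path with 3 vertices having both endpoints in V_i; (ii) there is no path with m+1 vertices having its two endpoints in distinct parts V_i, V_j; and (iii) V_s is an independent set. Then G has at most m·n edges. -/

import Mathlib

open SimpleGraph

/-- At most `p.length` neighbours of the last vertex of a walk `p` lie on `p`. -/
lemma SimpleGraph.Walk.degree_le_length_add_card_sdiff {V : Type*} [Fintype V] [DecidableEq V]
    {H : SimpleGraph V} [DecidableRel H.Adj] {a u : V} (p : H.Walk a u) :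
    H.degree u ≤ p.length + (H.neighborFinset u \ p.support.toFinset).card := by
  have hsub : H.neighborFinset u ∩ p.support.toFinset ⊆ p.support.toFinset.erase u := by
    intro x hx
    simp only [Finset.mem_inter, mem_neighborFinset, List.mem_toFinset] at hx
    simp only [Finset.mem_erase, List.mem_toFinset]
    exact ⟨hx.1.ne', hx.2⟩
  have hle := Finset.card_le_card hsub
  rw [Finset.card_erase_of_mem (by simp)] at hle
  have hsupp := p.support.toFinset_card_le
  rw [p.length_support] at hsupp
  have hsplit := Finset.card_inter_add_card_sdiff (H.neighborFinset u) p.support.toFinset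
  rw [card_neighborFinset_eq_degree] at hsplit
  omega

/-- If every non-isolated vertex has degree at least `m`, then a non-isolated vertex starts paths
of every length `k ≤ m`, ending in a non-isolated vertex. -/
lemma SimpleGraph.exists_isPath_length_eq_of_le_degree {V : Type*} [Fintype V]
    {H : SimpleGraph V} [DecidableRel H.Adj] {m : ℕ} (hdeg : ∀ v ∈ H.support, m ≤ H.degree v)
    {a : V} (ha : a ∈ H.support) :
    ∀ k ≤ m, ∃ u ∈ H.support, ∃ p : H.Walk a u, p.IsPath ∧ p.length = k := by
  classical
  intro k
  induction k with
  | zero => exact fun _ => ⟨a, ha, Walk.nil, Walk.IsPath.nil, rfl⟩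
  | succ k ih =>
    intro hk
    obtain ⟨u, hu, p, hp, hlen⟩ := ih (by omega)
    have hcard := p.degree_le_length_add_card_sdiff
    have hu_deg := hdeg u hu
    obtain ⟨w, hw⟩ : (H.neighborFinset u \ p.support.toFinset).Nonempty :=
      Finset.card_pos.mp (by omega)
    simp only [Finset.mem_sdiff, mem_neighborFinset, List.mem_toFinset] at hw
    exact ⟨w, ⟨u, hw.1.symm⟩, p.concat hw.1, hp.concat hw.2 hw.1, by
      rw [Walk.length_concat, hlen]⟩

/-- A graph all of whose nonempty subgraphs have a non-isolated vertex of degree at most `m`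
has at most `m` edges per non-isolated vertex. -/
lemma SimpleGraph.ncard_edgeSet_le_mul_ncard_support {V : Type*} [Finite V] {m : ℕ}
    (G : SimpleGraph V)
    (hG : ∀ H ≤ G, H ≠ ⊥ → ∃ v ∈ H.support, (H.neighborSet v).ncard ≤ m) :
    G.edgeSet.ncard ≤ m * G.support.ncard := by
  induction hk : G.support.ncard using Nat.strong_induction_on generalizing G with
  | _ k ih =>
    subst hk
    by_cases hbot : G = ⊥
    · simp [hbot]
    obtain ⟨v, hv, hdeg⟩ := hG G le_rfl hbot
    have hle : G.deleteIncidenceSet v ≤ G := G.deleteIncidenceSet_le v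
    have hlt : (G.deleteIncidenceSet v).support.ncard < G.support.ncard := by
      refine Set.ncard_lt_ncard ⟨support_mono hle, fun h => ?_⟩ (Set.toFinite _)
      obtain ⟨w, hw⟩ := h hv
      simp [deleteIncidenceSet_adj] at hw
    have hrec := ih _ hlt (G.deleteIncidenceSet v) (fun H hH => hG H (hH.trans hle)) rfl
    have hinc : (G.incidenceSet v).ncard ≤ m := by
      classical
      rwa [Set.ncard_congr' (G.incidenceSetEquivNeighborSet v)]
    have hsub : G.edgeSet.ncard ≤ (G.deleteIncidenceSet v).edgeSet.ncard + m := by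
      rw [edgeSet_deleteIncidenceSet]
      have := Set.le_ncard_sdiff (G.incidenceSet v) G.edgeSet (Set.toFinite _)
      omega
    calc G.edgeSet.ncard ≤ m * (G.deleteIncidenceSet v).support.ncard + m := by omega
      _ = m * ((G.deleteIncidenceSet v).support.ncard + 1) := by ring
      _ ≤ m * G.support.ncard := Nat.mul_le_mul_left m hlt

/-- Let `m, s ≥ 1` and let `G` be a graph on `n` vertices whose vertex set is partitioned
into `V_1, ..., V_{s+1}` (indexed by `Fin (s+1)`, the last part playing the role of `V_s`
in the paper) such that: (i) no part other than the last contains both endpoints of a path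
with 3 vertices; (ii) no path with `m+1` vertices has its endpoints in two distinct parts;
(iii) the last part is an independent set. Then `G` has at most `m·n` edges. -/
theorem stmt_8 {V : Type*} [Fintype V] (G : SimpleGraph V) (m s : ℕ) (hm : 1 ≤ m)
    (P : Fin (s + 1) → Set V)
    (hcover : ∀ v : V, ∃ i, v ∈ P i)
    (hdisj : ∀ i j, i ≠ j → ∀ v, v ∈ P i → v ∉ P j)
    (h1 : ∀ i : Fin s, ∀ a b c : V, a ∈ P i.castSucc → c ∈ P i.castSucc →
      G.Adj a b → G.Adj b c → a ≠ c → False)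
    (h2 : ∀ i j : Fin (s + 1), i ≠ j → ∀ (a b : V) (p : G.Walk a b),
      p.IsPath → p.length = m → a ∈ P i → b ∈ P j → False)
    (h3 : ∀ a b : V, a ∈ P (Fin.last s) → b ∈ P (Fin.last s) → ¬G.Adj a b) :
    G.edgeSet.ncard ≤ m * Fintype.card V := by
  classical
  refine (G.ncard_edgeSet_le_mul_ncard_support fun H hH hbot => ?_).trans
    (Nat.mul_le_mul_left m (by simpa using Set.ncard_le_card G.support))
  by_contra! hlarge
  have hdeg : ∀ v ∈ H.support, m < H.degree v := by
    intro v hv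
    have := hlarge v hv
    rwa [Set.ncard_eq_toFinset_card', ← neighborFinset_def, card_neighborFinset_eq_degree] at this
  obtain ⟨a, ha, i, hai⟩ : ∃ a ∈ H.support, ∃ i : Fin s, a ∈ P i.castSucc := by
    obtain ⟨x, y, hxy⟩ := ne_bot_iff_exists_adj.mp hbot
    obtain ⟨i, hi⟩ := hcover x
    obtain ⟨j, hj⟩ := hcover y
    induction i using Fin.lastCases with
    | cast i => exact ⟨x, ⟨y, hxy⟩, i, hi⟩
    | last =>
      induction j using Fin.lastCases with
      | cast j => exact ⟨y, ⟨x, hxy.symm⟩, j, hj⟩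
      | last => exact (h3 x y hi hj (hH hxy)).elim
  obtain ⟨u, hu, p, hp, hlen⟩ :=
    exists_isPath_length_eq_of_le_degree (fun v hv => (hdeg v hv).le) ha (m - 1) (by omega)
  have hfresh : ∀ w ∈ H.neighborFinset u \ p.support.toFinset, w ∈ P i.castSucc := by
    intro w hw
    simp only [Finset.mem_sdiff, mem_neighborFinset, List.mem_toFinset] at hw
    obtain ⟨j, hj⟩ := hcover w
    by_cases hij : i.castSucc = j
    · rwa [hij]
    · refine (h2 _ j hij a w ((p.concat hw.1).mapLe hH) ?_ ?_ hai hj).elim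
      · exact (Walk.isPath_mapLe hH).mpr (hp.concat hw.2 hw.1)
      · simp only [Walk.length_map, Walk.mapLe, Walk.length_concat]
        omega
  have hcard := p.degree_le_length_add_card_sdiff
  have hu_deg := hdeg u hu
  obtain ⟨w, hw, w', hw', hne⟩ :=
    Finset.one_lt_card.mp (show 1 < (H.neighborFinset u \ p.support.toFinset).card by omega)
  have hadj : ∀ x ∈ H.neighborFinset u \ p.support.toFinset, G.Adj u x := fun x hx =>
    hH ((mem_neighborFinset H u x).mp (Finset.mem_sdiff.mp hx).1)
  exact h1 i w u w' (hfresh w hw) (hfresh w' hw') (hadj w hw).symm (hadj w' hw') hne
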